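/- arXiv:2008.01406 — 2 statements merged into one kernel-verified Lean document; each statement's English description precedes it below -/
import Mathlib

section
/- Let (X,d) be an unbounded noncomplete metric space with d(x) > 0 for every x ∈ X, and let h be its hyperbolization metric. Let x, y, z ∈ ∂X be three distinct boundary points, let {x_n}, {y_n}, {z_n} be sequences in X converging in X̄ to x, y, z respectively, and let {u_n} be a sequence in X with d(u_n, p) → ∞ for every p ∈ X. Then limsup_{n→∞} [ (x_n|z_n)^h_{u_n} − (x_n|y_n)^h_{u_n} ] ≤ log( d̄(x,y)/d̄(x,z) ), where d̄ denotes the distance in the completion X̄ and the Gromov products are taken with respect to the metric h. -/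
open Metric Filter Set

noncomputable section

universe u v

/-- Gromov product of `x` and `y` with respect to base point `w`,
for a real-valued distance kernel `ρ`. -/
def gromovProd {X : Type u} (ρ : X → X → ℝ) (w x y : X) : ℝ :=
  (ρ x w + ρ y w - ρ x y) / 2

/-- `(X, ρ)` is δ-hyperbolic. -/
def IsDeltaHyp {X : Type u} (ρ : X → X → ℝ) (δ : ℝ) : Prop :=
  ∀ x y z w : X, gromovProd ρ w x y ≥ min (gromovProd ρ w x z) (gromovProd ρ w z y) - δ

/-- `f` is a (λ,μ)-rough similarity. -/
def RoughSimilarity {X : Type u} {Y : Type v} [MetricSpace X] [MetricSpace Y]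
    (lam mu : ℝ) (f : X → Y) : Prop :=
  (∀ y : Y, ∃ x : X, dist y (f x) ≤ mu) ∧
  (∀ x x' : X, lam * dist x x' - mu ≤ dist (f x) (f x') ∧
    dist (f x) (f x') ≤ lam * dist x x' + mu)

/-- The distance from `x ∈ X` to the metric boundary `∂X = X̄ \ X`. -/
def distToBdry (X : Type u) [MetricSpace X] (x : X) : ℝ :=
  Metric.infDist (x : UniformSpace.Completion X)
    (Set.range ((↑) : X → UniformSpace.Completion X))ᶜ

/-- `X` is noncomplete, i.e. `∂X = X̄ \ X ≠ ∅`. -/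
def IsNoncomplete (X : Type u) [MetricSpace X] : Prop :=
  ((Set.range ((↑) : X → UniformSpace.Completion X))ᶜ).Nonempty

/-- Ibragimov's hyperbolization metric. -/
def hMetric (X : Type u) [MetricSpace X] (x y : X) : ℝ :=
  2 * Real.log ((dist x y + max (distToBdry X x) (distToBdry X y)) /
    Real.sqrt (distToBdry X x * distToBdry X y))

/-- The j̃-metric. -/
def jtMetric (X : Type u) [MetricSpace X] (x y : X) : ℝ :=
  (1 / 2) * Real.log ((1 + dist x y / distToBdry X x) * (1 + dist x y / distToBdry X y))

/-- The quasihyperbolic metric. -/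
def quasihyperbolic (X : Type u) [MetricSpace X] (x y : X) : ℝ :=
  sInf {r : ℝ | ∃ L : ℝ, 0 ≤ L ∧ ∃ γ : ℝ → X,
    LipschitzOnWith 1 γ (Set.Icc 0 L) ∧ γ 0 = x ∧ γ L = y ∧
    r = ∫ t in (0:ℝ)..L, (distToBdry X (γ t))⁻¹}

/-- `X` is an `A`-uniform metric space. -/
def IsUniformMS (X : Type u) [MetricSpace X] (A : ℝ) : Prop :=
  ∀ x y : X, ∃ L : ℝ, 0 ≤ L ∧ ∃ γ : ℝ → X,
    LipschitzOnWith 1 γ (Set.Icc 0 L) ∧ γ 0 = x ∧ γ L = y ∧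
    L ≤ A * dist x y ∧ ∀ t ∈ Set.Icc (0:ℝ) L, min t (L - t) ≤ A * distToBdry X (γ t)

/-- `X` is unbounded. -/
def IsUnbounded (X : Type u) [MetricSpace X] : Prop :=
  ¬ Bornology.IsBounded (Set.univ : Set X)

/-- The numerator of the quotient inside the logarithm of `hMetric`. -/
def hNumerator (X : Type u) [MetricSpace X] (x y : X) : ℝ :=
  dist x y + max (distToBdry X x) (distToBdry X y)

theorem hNumerator_pos {X : Type u} [MetricSpace X] (hd : ∀ p : X, 0 < distToBdry X p)
    (x y : X) : 0 < hNumerator X x y :=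
  add_pos_of_nonneg_of_pos dist_nonneg (lt_max_of_lt_left (hd x))

theorem hMetric_eq {X : Type u} [MetricSpace X] (hd : ∀ p : X, 0 < distToBdry X p) (x y : X) :
    hMetric X x y = 2 * Real.log (hNumerator X x y) -
      (Real.log (distToBdry X x) + Real.log (distToBdry X y)) := by
  have hxy : 0 < distToBdry X x * distToBdry X y := mul_pos (hd x) (hd y)
  change 2 * Real.log (hNumerator X x y / _) = _
  rw [Real.log_div (hNumerator_pos hd x y).ne' (Real.sqrt_pos.2 hxy).ne',
    Real.log_sqrt hxy.le, Real.log_mul (hd x).ne' (hd y).ne']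
  ring

theorem gromovProd_hMetric_sub {X : Type u} [MetricSpace X] (hd : ∀ p : X, 0 < distToBdry X p)
    (u x y z : X) :
    gromovProd (hMetric X) u x z - gromovProd (hMetric X) u x y =
      Real.log (hNumerator X z u / hNumerator X y u) +
        Real.log (hNumerator X x y / hNumerator X x z) := by
  rw [Real.log_div (hNumerator_pos hd _ _).ne' (hNumerator_pos hd _ _).ne',
    Real.log_div (hNumerator_pos hd _ _).ne' (hNumerator_pos hd _ _).ne']
  simp only [gromovProd, hMetric_eq hd]
  ring

theorem tendsto_distToBdry_zero {X : Type u} [MetricSpace X] {x : UniformSpace.Completion X}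
    (hx : x ∈ (Set.range ((↑) : X → UniformSpace.Completion X))ᶜ) {xs : ℕ → X}
    (hxs : Tendsto (fun n => ((xs n : UniformSpace.Completion X))) atTop (nhds x)) :
    Tendsto (fun n => distToBdry X (xs n)) atTop (nhds 0) := by
  rw [← Metric.infDist_zero_of_mem hx]
  exact ((Metric.continuous_infDist_pt _).tendsto x).comp hxs

theorem tendsto_dist_of_tendsto_coe {X : Type u} [MetricSpace X]
    {x y : UniformSpace.Completion X} {xs ys : ℕ → X}
    (hxs : Tendsto (fun n => ((xs n : UniformSpace.Completion X))) atTop (nhds x))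
    (hys : Tendsto (fun n => ((ys n : UniformSpace.Completion X))) atTop (nhds y)) :
    Tendsto (fun n => dist (xs n) (ys n)) atTop (nhds (dist x y)) := by
  simpa only [UniformSpace.Completion.dist_eq] using hxs.dist hys

theorem tendsto_hNumerator {X : Type u} [MetricSpace X] {x y : UniformSpace.Completion X}
    (hx : x ∈ (Set.range ((↑) : X → UniformSpace.Completion X))ᶜ)
    (hy : y ∈ (Set.range ((↑) : X → UniformSpace.Completion X))ᶜ) {xs ys : ℕ → X}
    (hxs : Tendsto (fun n => ((xs n : UniformSpace.Completion X))) atTop (nhds x))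
    (hys : Tendsto (fun n => ((ys n : UniformSpace.Completion X))) atTop (nhds y)) :
    Tendsto (fun n => hNumerator X (xs n) (ys n)) atTop (nhds (dist x y)) := by
  simpa [hNumerator] using (tendsto_dist_of_tendsto_coe hxs hys).add
    ((tendsto_distToBdry_zero hx hxs).max (tendsto_distToBdry_zero hy hys))

theorem tendsto_hNumerator_atTop {X : Type u} [MetricSpace X] (hd : ∀ p : X, 0 < distToBdry X p)
    {y : UniformSpace.Completion X} {ys us : ℕ → X}
    (hys : Tendsto (fun n => ((ys n : UniformSpace.Completion X))) atTop (nhds y))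
    (hus : ∀ p : X, Tendsto (fun n => dist (us n) p) atTop atTop) :
    Tendsto (fun n => hNumerator X (ys n) (us n)) atTop atTop := by
  have hconst : Tendsto (fun n => dist (ys n) (ys 0)) atTop
      (nhds (dist y (ys 0 : UniformSpace.Completion X))) :=
    tendsto_dist_of_tendsto_coe hys (ys := fun _ => ys 0) tendsto_const_nhds
  refine tendsto_atTop_mono (fun n => ?_) ((hus (ys 0)).atTop_add hconst.neg)
  have hmax : 0 < max (distToBdry X (ys n)) (distToBdry X (us n)) := lt_max_of_lt_left (hd _)
  have htri := dist_triangle_left (us n) (ys 0) (ys n)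
  simp only [hNumerator]
  linarith

theorem abs_distToBdry_sub_le {X : Type u} [MetricSpace X] (x y : X) :
    |distToBdry X x - distToBdry X y| ≤ dist x y := by
  rw [← UniformSpace.Completion.dist_eq, ← Real.dist_eq]
  simpa [distToBdry] using (Metric.lipschitz_infDist_pt
    (Set.range ((↑) : X → UniformSpace.Completion X))ᶜ).dist_le_mul x y

theorem abs_hNumerator_sub_le {X : Type u} [MetricSpace X] (y z u : X) :
    |hNumerator X z u - hNumerator X y u| ≤ 2 * dist z y := by
  have hmax := (abs_max_sub_max_le_abs (distToBdry X z) (distToBdry X y) (distToBdry X u)).trans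
    (abs_distToBdry_sub_le z y)
  have hdist := abs_dist_sub_le z y u
  calc |hNumerator X z u - hNumerator X y u|
      = |(dist z u - dist y u) + (max (distToBdry X z) (distToBdry X u) -
          max (distToBdry X y) (distToBdry X u))| := by simp only [hNumerator]; ring_nf
    _ ≤ _ := (abs_add_le _ _).trans (by linarith)

theorem tendsto_hNumerator_div_one {X : Type u} [MetricSpace X]
    (hd : ∀ p : X, 0 < distToBdry X p) {y z : UniformSpace.Completion X} {ys zs us : ℕ → X}
    (hys : Tendsto (fun n => ((ys n : UniformSpace.Completion X))) atTop (nhds y))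
    (hzs : Tendsto (fun n => ((zs n : UniformSpace.Completion X))) atTop (nhds z))
    (hus : ∀ p : X, Tendsto (fun n => dist (us n) p) atTop atTop) :
    Tendsto (fun n => hNumerator X (zs n) (us n) / hNumerator X (ys n) (us n)) atTop
      (nhds 1) := by
  have hbound : Tendsto (fun n => 2 * dist (zs n) (ys n) / hNumerator X (ys n) (us n)) atTop
      (nhds 0) :=
    ((tendsto_dist_of_tendsto_coe hzs hys).const_mul 2).div_atTop
      (tendsto_hNumerator_atTop hd hys hus)
  rw [tendsto_iff_dist_tendsto_zero]
  refine squeeze_zero (fun _ => dist_nonneg) (fun n => ?_) hbound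
  have hpos := hNumerator_pos hd (ys n) (us n)
  rw [Real.dist_eq, div_sub_one hpos.ne', abs_div, abs_of_pos hpos]
  gcongr
  exact abs_hNumerator_sub_le _ _ _

/-- limsup estimate for differences of Gromov products of the
hyperbolization metric along sequences converging to distinct boundary points. -/
theorem hMetric_gromovProd_limsup_estimate
    {X : Type u} [MetricSpace X] (hub : IsUnbounded X) (hnc : IsNoncomplete X)
    (hd : ∀ p : X, 0 < distToBdry X p)
    (x y z : UniformSpace.Completion X)
    (hx : x ∈ (Set.range ((↑) : X → UniformSpace.Completion X))ᶜ)
    (hy : y ∈ (Set.range ((↑) : X → UniformSpace.Completion X))ᶜ)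
    (hz : z ∈ (Set.range ((↑) : X → UniformSpace.Completion X))ᶜ)
    (hxy : x ≠ y) (hyz : y ≠ z) (hxz : x ≠ z)
    (xs ys zs us : ℕ → X)
    (hxs : Tendsto (fun n => ((xs n : UniformSpace.Completion X))) atTop (nhds x))
    (hys : Tendsto (fun n => ((ys n : UniformSpace.Completion X))) atTop (nhds y))
    (hzs : Tendsto (fun n => ((zs n : UniformSpace.Completion X))) atTop (nhds z))
    (hus : ∀ p : X, Tendsto (fun n => dist (us n) p) atTop atTop) :
    Filter.limsup (fun n =>
        gromovProd (hMetric X) (us n) (xs n) (zs n) -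
          gromovProd (hMetric X) (us n) (xs n) (ys n)) atTop ≤
      Real.log (dist x y / dist x z) := by
  have hlog_one : Tendsto (fun n => Real.log
      (hNumerator X (zs n) (us n) / hNumerator X (ys n) (us n))) atTop (nhds 0) := by
    simpa using (tendsto_hNumerator_div_one hd hys hzs hus).log one_ne_zero
  have hlog : Tendsto (fun n => Real.log
      (hNumerator X (xs n) (ys n) / hNumerator X (xs n) (zs n))) atTop
      (nhds (Real.log (dist x y / dist x z))) :=
    ((tendsto_hNumerator hx hy hxs hys).div (tendsto_hNumerator hx hz hxs hzs)
      (dist_pos.2 hxz).ne').log (div_pos (dist_pos.2 hxy) (dist_pos.2 hxz)).ne'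
  simp only [gromovProd_hMetric_sub hd]
  simpa using (hlog_one.add hlog).limsup_eq.le

end
end

section
/- There exists a universal constant δ' ≥ 0 such that for every noncomplete metric space (X,d) with d(x) > 0 for every x ∈ X, the space (X, j̃) is δ'-hyperbolic, i.e. (x|y)^{j̃}_w ≥ min((x|z)^{j̃}_w, (z|y)^{j̃}_w) − δ' for all x, y, z, w ∈ X. -/
open Metric Filter Set

noncomputable section

universe u v

/-- The distance to the metric boundary is 1-Lipschitz. -/
theorem distToBdry_le_add_dist (X : Type u) [MetricSpace X] (x y : X) :
    distToBdry X x ≤ distToBdry X y + dist x y := by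
  rw [← UniformSpace.Completion.dist_eq x y]
  exact Metric.infDist_le_infDist_add_dist

/-- A weak Ptolemy inequality for positive symmetric kernels satisfying the triangle inequality. -/
theorem mul_le_four_mul_or_mul_le_four_mul_of_triangle {X : Type u} {m : X → X → ℝ}
    (hpos : ∀ a b, 0 < m a b) (hsymm : ∀ a b, m a b = m b a)
    (htri : ∀ a b c, m a c ≤ m a b + m b c) (x y z w : X) :
    m x y * m z w ≤ 4 * (m x z * m y w) ∨ m x y * m z w ≤ 4 * (m z y * m x w) := by
  have key : ∀ {a b c d : ℝ}, 0 < b → 0 < c → 0 < d → a ≤ 2 * c → b ≤ 2 * d →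
      a * b ≤ 4 * (c * d) := by
    intro a b c d hb hc hd h₁ h₂
    calc a * b ≤ (2 * c) * (2 * d) := by gcongr
      _ = 4 * (c * d) := by ring
  have hxzy := htri x z y
  have hxwy := htri x w y
  have hzxw := htri z x w
  have hzyw := htri z y w
  rw [hsymm w y] at hxwy
  rw [hsymm z x] at hzxw
  have p := hpos z w
  have p₁ := hpos x z
  have p₂ := hpos y w
  have p₃ := hpos z y
  have p₄ := hpos x w
  rcases le_total (m x z) (m z y) with h₁ | h₁ <;>
  rcases le_total (m x z) (m x w) with h₂ | h₂ <;>
  rcases le_total (m y w) (m z y) with h₃ | h₃ <;>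
  rcases le_total (m y w) (m x w) with h₄ | h₄ <;>
  first
  | exact Or.inr (key p p₃ p₄ (by linarith) (by linarith))
  | exact Or.inl (key p p₁ p₂ (by linarith) (by linarith))
  | (right; rw [mul_comm (m z y)]; exact key p p₄ p₃ (by linarith) (by linarith))
  | (left; rw [mul_comm (m x z)]; exact key p p₂ p₁ (by linarith) (by linarith))

/-- The j̃-metric agrees, up to an additive constant, with a logarithmic kernel built from
`dist x y + max (d x) (d y)`. -/
theorem jtMetric_bounds (X : Type u) [MetricSpace X] (hd : ∀ x : X, 0 < distToBdry X x)
    (x y : X) :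
    jtMetric X x y ≤ Real.log (dist x y + max (distToBdry X x) (distToBdry X y)) -
        Real.log (distToBdry X x) / 2 - Real.log (distToBdry X y) / 2 ∧
      Real.log (dist x y + max (distToBdry X x) (distToBdry X y)) -
        Real.log (distToBdry X x) / 2 - Real.log (distToBdry X y) / 2 - Real.log 2 / 2 ≤
        jtMetric X x y := by
  have hx := hd x
  have hy := hd y
  have hxy := distToBdry_le_add_dist X x y
  have hyx := distToBdry_le_add_dist X y x
  rw [dist_comm y x] at hyx
  have h0 : 0 ≤ dist x y := dist_nonneg
  unfold jtMetric
  generalize distToBdry X x = a at *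
  generalize distToBdry X y = b at *
  generalize dist x y = t at *
  have e : (1 + t / a) * (1 + t / b) = (t + a) * (t + b) / (a * b) := by
    field_simp
    ring
  have hM : 0 < t + max a b := by positivity
  rw [e, Real.log_div (by positivity) (by positivity), Real.log_mul hx.ne' hy.ne']
  have upper : (t + a) * (t + b) ≤ (t + max a b) ^ 2 := by
    rw [sq]
    gcongr
    · exact le_max_left _ _
    · exact le_max_right _ _
  have lower : (t + max a b) ^ 2 ≤ 2 * ((t + a) * (t + b)) := by
    rcases le_total a b with h | h
    · rw [max_eq_right h]
      nlinarith
    · rw [max_eq_left h]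
      nlinarith
  have hu := Real.log_le_log (by positivity) upper
  have hl := Real.log_le_log (by positivity) lower
  rw [Real.log_pow] at hu hl
  rw [Real.log_mul two_ne_zero (by positivity)] at hl
  push_cast at hu hl
  constructor <;> linarith

/-- the j̃-metric is δ'-hyperbolic with a universal constant δ'. -/
theorem jtMetric_hyperbolic :
    ∃ δ' : ℝ, 0 ≤ δ' ∧
      ∀ (X : Type u) [MetricSpace X], IsNoncomplete X →
        (∀ x : X, 0 < distToBdry X x) →
        IsDeltaHyp (jtMetric X) δ' := by
  refine ⟨(Real.log 4 + Real.log 2) / 2, by positivity, ?_⟩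
  intro X _ _ hd x y z w
  let m : X → X → ℝ := fun a b => dist a b + max (distToBdry X a) (distToBdry X b)
  have hpos : ∀ a b, 0 < m a b := fun a b =>
    add_pos_of_nonneg_of_pos dist_nonneg (lt_max_of_lt_left (hd a))
  have hsymm : ∀ a b, m a b = m b a := fun a b => by
    simp only [m, dist_comm a b, max_comm (distToBdry X a)]
  have htri : ∀ a b c, m a c ≤ m a b + m b c := fun a b c => by
    have h₁ := dist_triangle a b c
    have h₂ : max (distToBdry X a) (distToBdry X c) ≤
        max (distToBdry X a) (distToBdry X b) + max (distToBdry X b) (distToBdry X c) :=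
      max_le
        ((le_max_left _ _).trans
          (le_add_of_nonneg_right (lt_max_of_lt_left (hd b)).le))
        ((le_max_right _ _).trans
          (le_add_of_nonneg_left (lt_max_of_lt_left (hd a)).le))
    simp only [m]
    linarith
  have hlog : ∀ {a b c d e f g h : X}, m a b * m c d ≤ 4 * (m e f * m g h) →
      Real.log (m a b) + Real.log (m c d) ≤
        Real.log 4 + (Real.log (m e f) + Real.log (m g h)) := by
    intro a b c d e f g h hle
    rw [← Real.log_mul (hpos _ _).ne' (hpos _ _).ne', ← Real.log_mul (hpos _ _).ne' (hpos _ _).ne',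
      ← Real.log_mul four_ne_zero (mul_pos (hpos _ _) (hpos _ _)).ne']
    exact Real.log_le_log (mul_pos (hpos _ _) (hpos _ _)) hle
  have hxy := (jtMetric_bounds X hd x y).1
  have hzw := (jtMetric_bounds X hd z w).1
  have hxz := (jtMetric_bounds X hd x z).2
  have hyw := (jtMetric_bounds X hd y w).2
  have hzy := (jtMetric_bounds X hd z y).2
  have hxw := (jtMetric_bounds X hd x w).2
  unfold gromovProd
  rw [ge_iff_le, sub_le_iff_le_add, min_le_iff]
  rcases mul_le_four_mul_or_mul_le_four_mul_of_triangle hpos hsymm htri x y z w with h | h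
  · left
    have := hlog h
    simp only [m] at this
    linarith
  · right
    have := hlog h
    simp only [m] at this
    linarith

end
end
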